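/- Fix r ∈ (1,2) and let ψ:[0,1]→[0,∞) be ψ(s) := s(12 − log s)(log(12 − log s))^r for 0 < s ≤ 1 and ψ(0) := 0. There exists a constant C(r) > 0, independent of k and of the choices of the intervals I(J), such that for every K ∈ 𝐊: ‖w_k‖_{Λ_ψ(K)} ≤ C(r)·3^k·k^r·⟨w_k⟩_K and ‖σ_k‖_{Λ_ψ(K)} ≤ C(r)·⟨w_k⟩_K^{−1}. -/

import Mathlib

open MeasureTheory Set Filter

noncomputable section

namespace RTpaper

/-- The half-open interval `[a, b)` represented by the pair `(a, b)`. -/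
def ivSet (I : ℝ × ℝ) : Set ℝ := Set.Ico I.1 I.2

/-- The length of the interval represented by `I`. -/
def len (I : ℝ × ℝ) : ℝ := I.2 - I.1

/-- The middle triadic child of an interval. -/
def mid (I : ℝ × ℝ) : ℝ × ℝ := (I.1 + (I.2 - I.1) / 3, I.2 - (I.2 - I.1) / 3)

/-- The families `𝐊ᵢ` of the Reguera–Thiele construction. -/
def Kfam (k : ℕ) : ℕ → Set (ℝ × ℝ)
  | 0 => {((0 : ℝ), (1 : ℝ))}
  | (i + 1) =>
      {I | ∃ K ∈ Kfam k i, ∃ j : ℕ, j < 3 ^ (k - 1) ∧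
        I = ((mid K).1 + (j : ℝ) * ((3 : ℝ) ^ (1 - (k : ℤ)) * len (mid K)),
             (mid K).1 + ((j : ℝ) + 1) * ((3 : ℝ) ^ (1 - (k : ℤ)) * len (mid K)))}

/-- The families `𝐉ᵢ` (of interest for `i ≥ 1`). -/
def Jfam (k i : ℕ) : Set (ℝ × ℝ) := {J | ∃ K ∈ Kfam k (i - 1), J = mid K}

/-- The family `𝐊 = ⋃ᵢ 𝐊ᵢ`. -/
def KK (k : ℕ) : Set (ℝ × ℝ) := ⋃ i, Kfam k i

/-- The family `𝐉 = ⋃_{i ≥ 1} 𝐉ᵢ`. -/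
def JJ (k : ℕ) : Set (ℝ × ℝ) := ⋃ i, Jfam k (i + 1)

/-- The chosen triadic interval `I(J)` adjacent to `J` of length `3^{1-k}|J|`, encoded by a
choice function `ch` deciding, for each `J`, whether `I(J)` lies to the right (`true`) or to
the left (`false`) of `J`. -/
def IJ (k : ℕ) (ch : ℝ × ℝ → Bool) (J : ℝ × ℝ) : ℝ × ℝ :=
  if ch J then (J.2, J.2 + (3 : ℝ) ^ (1 - (k : ℤ)) * len J)
  else (J.1 - (3 : ℝ) ^ (1 - (k : ℤ)) * len J, J.1)

/-- The weight `w_k = Σ_{i ≥ 1} Σ_{J ∈ 𝐉ᵢ} (3^k/(3^{k-1}+1))^i · 1_{I(J)}`. -/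
def wgt (k : ℕ) (ch : ℝ × ℝ → Bool) (x : ℝ) : ℝ :=
  ∑' i : ℕ, ∑' J : ↥(Jfam k (i + 1)),
    Set.indicator (ivSet (IJ k ch (J : ℝ × ℝ)))
      (fun _ => ((3 : ℝ) ^ k / ((3 : ℝ) ^ (k - 1) + 1)) ^ (i + 1)) x

/-- The weight `σ_k = w_k^{1-p}` on `{w_k > 0}`, and `0` elsewhere. -/
def sgm (p : ℝ) (k : ℕ) (ch : ℝ × ℝ → Bool) (x : ℝ) : ℝ :=
  if 0 < wgt k ch x then wgt k ch x ^ (1 - p) else 0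

/-- `u(I) = ∫_I u`. -/
def mass (u : ℝ → ℝ) (I : ℝ × ℝ) : ℝ := ∫ x in ivSet I, u x

/-- `⟨u⟩_I = u(I)/|I|`. -/
def avg (u : ℝ → ℝ) (I : ℝ × ℝ) : ℝ := mass u I / len I

/-- `ch_𝐊(K)`: the members of `𝐊_{i+1}` contained in `K ∈ 𝐊ᵢ`. -/
def chK (k : ℕ) (K : ℝ × ℝ) : Set (ℝ × ℝ) :=
  {K' | ∃ i, K ∈ Kfam k i ∧ K' ∈ Kfam k (i + 1) ∧ ivSet K' ⊆ ivSet K}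

/-- Triadic intervals of `ℝ`. -/
def IsTriadic (I : ℝ × ℝ) : Prop :=
  ∃ n j : ℤ, I.1 = (j : ℝ) * (3 : ℝ) ^ (-n) ∧ I.2 = ((j : ℝ) + 1) * (3 : ℝ) ^ (-n)

/-- Maximal members of `S` strictly contained in `R`. -/
def maxIn (S : Set (ℝ × ℝ)) (R : ℝ × ℝ) : Set (ℝ × ℝ) :=
  {Q | Q ∈ S ∧ ivSet Q ⊂ ivSet R ∧
    ∀ Q' ∈ S, ivSet Q ⊆ ivSet Q' → ivSet Q' ⊂ ivSet R → ivSet Q' = ivSet Q}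

/-- Martingale `ε`-sparse families of (half-open) intervals. -/
def MSparse (ε : ℝ) (S : Set (ℝ × ℝ)) : Prop :=
  S.Countable ∧ (∀ I ∈ S, I.1 < I.2) ∧
    (∀ I ∈ S, ∀ J ∈ S, ivSet I ⊆ ivSet J ∨ ivSet J ⊆ ivSet I ∨ ivSet I ∩ ivSet J = ∅) ∧
    ∀ R ∈ S, (∑' Q : ↥(maxIn S R), len (Q : ℝ × ℝ)) ≤ ε * len R

/-- `Σ_{I ∈ F} ⟨u⟩_I^q · ⟨v⟩_I · |I|`. -/
def sumTest (q : ℝ) (u v : ℝ → ℝ) (F : Set (ℝ × ℝ)) : ℝ :=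
  ∑' I : ↥F, avg u (I : ℝ × ℝ) ^ q * avg v (I : ℝ × ℝ) * len (I : ℝ × ℝ)


/-- The weight `σ_k = 1/w_k` on `{w_k > 0}`, and `0` elsewhere (case `p = 2`). -/
def sgm2 (k : ℕ) (ch : ℝ × ℝ → Bool) (x : ℝ) : ℝ :=
  if 0 < wgt k ch x then (wgt k ch x)⁻¹ else 0

/-- The Lorentz quasinorm `‖f‖_{Λ_φ(I)} = ∫_0^∞ φ(|{x ∈ I : f(x) > t}|/|I|) dt`. -/
def lorentz (φ : ℝ → ℝ) (f : ℝ → ℝ) (I : ℝ × ℝ) : ℝ :=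
  ∫ t in Set.Ioi (0 : ℝ), φ ((volume {x | x ∈ ivSet I ∧ t < f x}).toReal / len I)

/-- The fundamental function `φ₀(s) = s(1 - log s)` of `L log L` (note `φ₀(0) = 0`,
as `Real.log 0 = 0`). -/
def phi0 (s : ℝ) : ℝ := s * (1 - Real.log s)

/-- The function `ψ(s) = s(12 - log s)(log(12 - log s))^r` (note `ψ(0) = 0`). -/
def psi (r s : ℝ) : ℝ := s * (12 - Real.log s) * Real.log (12 - Real.log s) ^ r

/-! ### Geometry of the construction -/

/-- The ratio `3^{1-k}`. -/
def zz (k : ℕ) : ℝ := (3 : ℝ) ^ (1 - (k : ℤ))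

lemma zz_mul {k : ℕ} (hk : 1 ≤ k) : (3 : ℝ) ^ (k - 1) * zz k = 1 := by
  unfold zz
  obtain ⟨m, rfl⟩ : ∃ m, k = m + 1 := ⟨k - 1, by omega⟩
  have : (1 - ((m + 1 : ℕ) : ℤ)) = -(m : ℤ) := by push_cast; ring
  rw [this, zpow_neg, zpow_natCast]
  simp

lemma zz_pos (k : ℕ) : 0 < zz k := by unfold zz; positivity

lemma zz_le {k : ℕ} (hk : 1 ≤ k) : zz k ≤ 1 := by
  have h := zz_mul hk
  have h1 : (1 : ℝ) ≤ 3 ^ (k - 1) := one_le_pow₀ (by norm_num)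
  nlinarith [zz_pos k]

/-- The `j`-th child. -/
def chd (k : ℕ) (K : ℝ × ℝ) (j : ℕ) : ℝ × ℝ :=
  ((mid K).1 + (j : ℝ) * (zz k * len (mid K)), (mid K).1 + ((j : ℝ) + 1) * (zz k * len (mid K)))

/-- The finite family of children of `K`. -/
def child (k : ℕ) (K : ℝ × ℝ) : Finset (ℝ × ℝ) := (Finset.range (3 ^ (k - 1))).image (chd k K)

/-- Descendants of generation `m`. -/
def DD (k : ℕ) (K : ℝ × ℝ) : ℕ → Finset (ℝ × ℝ)
  | 0 => {K}
  | (m + 1) => (DD k K m).biUnion (child k)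

lemma mem_child {k : ℕ} {K I : ℝ × ℝ} : I ∈ child k K ↔ ∃ j < 3 ^ (k - 1), chd k K j = I := by
  simp [child]

lemma Kfam_eq (k i : ℕ) : Kfam k i = ↑(DD k (0, 1) i) := by
  induction i with
  | zero => simp [Kfam, DD]
  | succ i ih =>
    ext I
    simp only [Kfam, DD, ih, Finset.coe_biUnion, mem_ofPred_eq, mem_iUnion, Finset.mem_coe,
      mem_child, exists_prop]
    constructor
    · rintro ⟨K, hK, j, hj, rfl⟩
      exact ⟨K, hK, j, hj, rfl⟩
    · rintro ⟨K, hK, j, hj, rfl⟩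
      exact ⟨K, hK, j, hj, rfl⟩

lemma len_mid (K : ℝ × ℝ) : len (mid K) = len K / 3 := by
  simp only [len, mid]; ring

lemma len_chd (k : ℕ) (K : ℝ × ℝ) (j : ℕ) : len (chd k K j) = zz k / 3 * len K := by
  have := len_mid K
  simp only [chd, this]
  simp only [len]; ring

lemma mid_sub {K : ℝ × ℝ} (h : 0 < len K) : ivSet (mid K) ⊆ ivSet K := by
  intro x
  simp only [ivSet, mid, mem_Ico, len] at *
  rintro ⟨h1, h2⟩
  constructor <;> linarith

lemma chd_sub {k : ℕ} (hk : 1 ≤ k) {K : ℝ × ℝ} (h : 0 < len K) {j : ℕ} (hj : j < 3 ^ (k - 1)) :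
    ivSet (chd k K j) ⊆ ivSet (mid K) := by
  intro x
  have hl : 0 < len (mid K) := by rw [len_mid]; linarith
  have hz := zz_mul hk
  have hj' : (j : ℝ) + 1 ≤ 3 ^ (k - 1) := by exact_mod_cast hj
  have hzp := zz_pos k
  have e : (mid K).2 = (mid K).1 + len (mid K) := by simp [len]
  simp only [ivSet, chd, mem_Ico]
  rintro ⟨h1, h2⟩
  have h3 : ((j : ℝ) + 1) * (zz k * len (mid K)) ≤ 3 ^ (k - 1) * (zz k * len (mid K)) := by
    gcongr
  have h4 : 0 ≤ (j : ℝ) * (zz k * len (mid K)) := by positivity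
  rw [← mul_assoc (3 ^ (k - 1) : ℝ), hz, one_mul] at h3
  rw [e]
  constructor <;> linarith

lemma chd_inj {k : ℕ} {K : ℝ × ℝ} (h : 0 < len K) {j j' : ℕ} {x : ℝ}
    (h1 : x ∈ ivSet (chd k K j)) (h2 : x ∈ ivSet (chd k K j')) : j = j' := by
  have hl : 0 < zz k * len (mid K) := by
    rw [len_mid]; have := zz_pos k; positivity
  simp only [ivSet, chd, mem_Ico] at h1 h2
  have a1 : (j : ℝ) < j' + 1 := lt_of_mul_lt_mul_right (by linarith) hl.le
  have a2 : (j' : ℝ) < j + 1 := lt_of_mul_lt_mul_right (by linarith) hl.le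
  have a1' : j < j' + 1 := by exact_mod_cast a1
  have a2' : j' < j + 1 := by exact_mod_cast a2
  omega

lemma fst_mem {K : ℝ × ℝ} (h : 0 < len K) : K.1 ∈ ivSet K := by
  simp only [ivSet, mem_Ico, len] at *
  constructor <;> linarith

lemma DD_len {k : ℕ} {K : ℝ × ℝ} (m : ℕ) :
    ∀ I ∈ DD k K m, len I = (zz k / 3) ^ m * len K := by
  induction m with
  | zero => intro I hI; simp [DD] at hI; simp [hI]
  | succ m ih =>
    intro I hI
    simp only [DD, Finset.mem_biUnion, mem_child] at hI
    obtain ⟨P, hP, j, -, rfl⟩ := hI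
    rw [len_chd, ih P hP]; ring

lemma DD_len_pos {k : ℕ} {K : ℝ × ℝ} (h : 0 < len K) (m : ℕ) :
    ∀ I ∈ DD k K m, 0 < len I := by
  intro I hI
  rw [DD_len m I hI]
  have := zz_pos k; positivity

lemma DD_sub {k : ℕ} (hk : 1 ≤ k) {K : ℝ × ℝ} (h : 0 < len K) (m : ℕ) :
    ∀ I ∈ DD k K m, ivSet I ⊆ ivSet K := by
  induction m with
  | zero => intro I hI; simp [DD] at hI; simp [hI]
  | succ m ih =>
    intro I hI
    simp only [DD, Finset.mem_biUnion, mem_child] at hI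
    obtain ⟨P, hP, j, hj, rfl⟩ := hI
    have hl := DD_len_pos h m P hP
    exact (chd_sub hk hl hj).trans ((mid_sub hl).trans (ih P hP))

lemma DD_uniq {k : ℕ} (hk : 1 ≤ k) {K : ℝ × ℝ} (h : 0 < len K) (m : ℕ) :
    ∀ I ∈ DD k K m, ∀ I' ∈ DD k K m, ∀ x, x ∈ ivSet I → x ∈ ivSet I' → I = I' := by
  induction m with
  | zero => intro I hI I' hI'; simp [DD] at hI hI'; simp [hI, hI']
  | succ m ih =>
    intro I hI I' hI' x hx hx'
    simp only [DD, Finset.mem_biUnion, mem_child] at hI hI'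
    obtain ⟨P, hP, j, hj, rfl⟩ := hI
    obtain ⟨P', hP', j', hj', rfl⟩ := hI'
    have hl := DD_len_pos h m P hP
    have hl' := DD_len_pos h m P' hP'
    have : P = P' := ih P hP P' hP' x (mid_sub hl (chd_sub hk hl hj hx))
      (mid_sub hl' (chd_sub hk hl' hj' hx'))
    subst this
    rw [chd_inj hl hx hx']

lemma child_card {k : ℕ} {K : ℝ × ℝ} (h : 0 < len K) : (child k K).card = 3 ^ (k - 1) := by
  rw [child, Finset.card_image_of_injective, Finset.card_range]
  intro j j' hjj
  have hp : 0 < len (chd k K j) := by rw [len_chd]; have := zz_pos k; positivity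
  have h1 := fst_mem hp
  exact chd_inj h h1 (by rw [← hjj]; exact h1)

lemma DD_card {k : ℕ} (hk : 1 ≤ k) {K : ℝ × ℝ} (h : 0 < len K) (m : ℕ) :
    (DD k K m).card = (3 ^ (k - 1)) ^ m := by
  induction m with
  | zero => simp [DD]
  | succ m ih =>
    rw [DD, Finset.card_biUnion]
    · rw [Finset.sum_congr rfl (fun P hP => child_card (DD_len_pos h m P hP))]
      rw [Finset.sum_const, ih, smul_eq_mul, pow_succ]
    · intro P hP P' hP' hne
      rw [Function.onFun, Finset.disjoint_left]
      intro I hI hI'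
      rw [mem_child] at hI hI'
      obtain ⟨j, hj, rfl⟩ := hI
      obtain ⟨j', hj', e⟩ := hI'
      have hl := DD_len_pos h m P hP
      have hl' := DD_len_pos h m P' hP'
      have hp : 0 < len (chd k P j) := by rw [len_chd]; have := zz_pos k; positivity
      have h1 := fst_mem hp
      have h2 : (chd k P j).1 ∈ ivSet (chd k P' j') := by rw [e]; exact h1
      exact hne (DD_uniq hk h m P hP P' hP' _ (mid_sub hl (chd_sub hk hl hj h1))
        (mid_sub hl' (chd_sub hk hl' hj' h2)))

lemma DD_add (k : ℕ) (K : ℝ × ℝ) (i m : ℕ) :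
    DD k K (i + m) = (DD k K i).biUnion (fun P => DD k P m) := by
  induction m with
  | zero => simp [DD]
  | succ m ih =>
    rw [← add_assoc, DD, ih, Finset.biUnion_biUnion]; rfl

lemma IJ_spec {k : ℕ} (hk : 1 ≤ k) (ch : ℝ × ℝ → Bool) {K : ℝ × ℝ} (h : 0 < len K) :
    ivSet (IJ k ch (mid K)) ⊆ ivSet K ∧ Disjoint (ivSet (IJ k ch (mid K))) (ivSet (mid K)) ∧
    len (IJ k ch (mid K)) = zz k / 3 * len K := by
  have hz := zz_le hk
  have hz0 := zz_pos k
  have hlm := len_mid K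
  have hzl : zz k * (len K / 3) ≤ len K / 3 := by nlinarith
  have hzl0 : 0 < zz k * (len K / 3) := by positivity
  unfold IJ
  change (ivSet (if ch (mid K) then ((mid K).2, (mid K).2 + zz k * len (mid K))
    else ((mid K).1 - zz k * len (mid K), (mid K).1)) ⊆ _ ∧ _ ∧ len (if ch (mid K) then ((mid K).2, (mid K).2 + zz k * len (mid K))
    else ((mid K).1 - zz k * len (mid K), (mid K).1)) = _)
  rw [hlm]
  split_ifs
  · refine ⟨?_, ?_, ?_⟩
    · intro x
      simp only [ivSet, mid, mem_Ico, len] at *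
      rintro ⟨h1, h2⟩
      constructor <;> linarith
    · rw [Set.disjoint_left]
      intro x
      simp only [ivSet, mem_Ico]
      rintro ⟨h1, h2⟩ ⟨h3, h4⟩
      linarith
    · simp only [len]; ring
  · refine ⟨?_, ?_, ?_⟩
    · intro x
      simp only [ivSet, mid, mem_Ico, len] at *
      rintro ⟨h1, h2⟩
      constructor <;> linarith
    · rw [Set.disjoint_left]
      intro x
      simp only [ivSet, mem_Ico]
      rintro ⟨h1, h2⟩ ⟨h3, h4⟩
      linarith
    · simp only [len]; ring

lemma len01 : 0 < len ((0 : ℝ), (1 : ℝ)) := by simp [len]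

/-- The set on which the `K`-term of the weight lives. -/
def BB (k : ℕ) (ch : ℝ × ℝ → Bool) (K : ℝ × ℝ) : Set ℝ := ivSet (IJ k ch (mid K))

lemma sep {k : ℕ} (hk : 1 ≤ k) (ch : ℝ × ℝ → Bool) {j1 j2 : ℕ} (hj : j1 < j2) {K1 K2 : ℝ × ℝ}
    (h1 : K1 ∈ DD k (0, 1) j1) (h2 : K2 ∈ DD k (0, 1) j2) {x : ℝ} (hx1 : x ∈ BB k ch K1)
    (hx2 : x ∈ ivSet K2) : False := by
  obtain ⟨d, rfl⟩ : ∃ d, j2 = (j1 + 1) + d := ⟨j2 - (j1 + 1), by omega⟩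
  rw [DD_add, Finset.mem_biUnion] at h2
  obtain ⟨P, hP, h2⟩ := h2
  have hPl := DD_len_pos len01 _ P hP
  have hxP := DD_sub hk hPl _ K2 h2 hx2
  simp only [DD, Finset.mem_biUnion, mem_child] at hP
  obtain ⟨K0, hK0, j, hj, rfl⟩ := hP
  have hl0 := DD_len_pos len01 _ K0 hK0
  have hxm := chd_sub hk hl0 hj hxP
  obtain ⟨a, b, -⟩ := IJ_spec hk ch (DD_len_pos len01 _ K1 h1)
  have : K1 = K0 := DD_uniq hk len01 _ K1 h1 K0 hK0 x (a hx1) (mid_sub hl0 hxm)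
  subst this
  exact Set.disjoint_left.1 b hx1 hxm

lemma BB_uniq {k : ℕ} (hk : 1 ≤ k) (ch : ℝ × ℝ → Bool) {j1 j2 : ℕ} {K1 K2 : ℝ × ℝ}
    (h1 : K1 ∈ DD k (0, 1) j1) (h2 : K2 ∈ DD k (0, 1) j2) {x : ℝ} (hx1 : x ∈ BB k ch K1)
    (hx2 : x ∈ BB k ch K2) : j1 = j2 ∧ K1 = K2 := by
  have s1 := (IJ_spec hk ch (DD_len_pos len01 _ K1 h1)).1 hx1
  have s2 := (IJ_spec hk ch (DD_len_pos len01 _ K2 h2)).1 hx2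
  rcases lt_trichotomy j1 j2 with h | h | h
  · exact (sep hk ch h h1 h2 hx1 s2).elim
  · subst h
    exact ⟨rfl, DD_uniq hk len01 _ K1 h1 K2 h2 x s1 s2⟩
  · exact (sep hk ch h h2 h1 hx2 s1).elim

lemma mid_inj : Function.Injective mid := by
  rintro ⟨a, b⟩ ⟨c, d⟩ h
  simp only [mid, Prod.mk.injEq] at h ⊢
  constructor <;> linarith [h.1, h.2]

/-- The ratio `3^k/(3^{k-1}+1)`. -/
def aa (k : ℕ) : ℝ := (3 : ℝ) ^ k / ((3 : ℝ) ^ (k - 1) + 1)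

/-- The `j`-th layer of the weight. -/
def GG (k : ℕ) (ch : ℝ × ℝ → Bool) (j : ℕ) (x : ℝ) : ℝ :=
  ∑ K ∈ DD k (0, 1) j, Set.indicator (BB k ch K) (fun _ => aa k ^ (j + 1)) x

lemma wgt_eq (k : ℕ) (ch : ℝ × ℝ → Bool) (x : ℝ) : wgt k ch x = ∑' j, GG k ch j x := by
  unfold wgt
  refine tsum_congr fun j => ?_
  have e : Jfam k (j + 1) = ↑((DD k (0, 1) j).image mid) := by
    ext J
    simp only [Jfam, Nat.add_sub_cancel, Kfam_eq, mem_ofPred_eq, Finset.mem_coe, Finset.mem_image]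
    constructor
    · rintro ⟨K, h, rfl⟩; exact ⟨K, h, rfl⟩
    · rintro ⟨K, h, rfl⟩; exact ⟨K, h, rfl⟩
  rw [e, Finset.tsum_subtype' _ (fun J => Set.indicator (ivSet (IJ k ch J))
      (fun _ => ((3 : ℝ) ^ k / ((3 : ℝ) ^ (k - 1) + 1)) ^ (j + 1)) x),
    Finset.sum_image (fun a _ b _ h => mid_inj h)]
  rfl

lemma GG_eq {k : ℕ} (hk : 1 ≤ k) (ch : ℝ × ℝ → Bool) {j1 : ℕ} {K1 : ℝ × ℝ}
    (h1 : K1 ∈ DD k (0, 1) j1) {x : ℝ} (hx1 : x ∈ BB k ch K1) (j : ℕ) :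
    GG k ch j x = if j = j1 then aa k ^ (j1 + 1) else 0 := by
  unfold GG
  split_ifs with h
  · subst h
    rw [Finset.sum_eq_single_of_mem K1 h1]
    · simp [hx1]
    · intro K2 h2 hne
      rw [Set.indicator_of_notMem]
      intro hx2
      exact hne (BB_uniq hk ch h1 h2 hx1 hx2).2.symm
  · apply Finset.sum_eq_zero
    intro K2 h2
    rw [Set.indicator_of_notMem]
    intro hx2
    exact h (BB_uniq hk ch h1 h2 hx1 hx2).1.symm

lemma wgt_of_mem {k : ℕ} (hk : 1 ≤ k) (ch : ℝ × ℝ → Bool) {j1 : ℕ} {K1 : ℝ × ℝ}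
    (h1 : K1 ∈ DD k (0, 1) j1) {x : ℝ} (hx1 : x ∈ BB k ch K1) :
    wgt k ch x = aa k ^ (j1 + 1) := by
  rw [wgt_eq, tsum_congr (GG_eq hk ch h1 hx1), tsum_ite_eq]

lemma exists_of_wgt_pos {k : ℕ} (ch : ℝ × ℝ → Bool) {x : ℝ} (hx : 0 < wgt k ch x) :
    ∃ j, ∃ K ∈ DD k (0, 1) j, x ∈ BB k ch K := by
  by_contra hcon
  push Not at hcon
  have : wgt k ch x = 0 := by
    rw [wgt_eq]
    convert tsum_zero with j
    unfold GG
    apply Finset.sum_eq_zero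
    intro K hK
    rw [Set.indicator_of_notMem (hcon j K hK)]
  linarith

/-- A point of `K ∈ 𝐊ᵢ` with positive weight lies in a piece belonging to a descendant. -/
lemma exists_desc {k : ℕ} (hk : 1 ≤ k) (ch : ℝ × ℝ → Bool) {i : ℕ} {K : ℝ × ℝ}
    (hK : K ∈ DD k (0, 1) i) {j : ℕ} {K' : ℝ × ℝ} (hK' : K' ∈ DD k (0, 1) j) {x : ℝ}
    (hxK : x ∈ ivSet K) (hx : x ∈ BB k ch K') : ∃ m, j = i + m ∧ K' ∈ DD k K m := by
  by_cases hj : j < i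
  · exact (sep hk ch hj hK' hK hx hxK).elim
  · obtain ⟨m, rfl⟩ : ∃ m, j = i + m := ⟨j - i, by omega⟩
    refine ⟨m, rfl, ?_⟩
    have h' := hK'
    rw [DD_add, Finset.mem_biUnion] at h'
    obtain ⟨P, hP, h'⟩ := h'
    have hx' := (IJ_spec hk ch (DD_len_pos len01 _ K' hK')).1 hx
    have hx'' := DD_sub hk (DD_len_pos len01 _ P hP) _ _ h' hx'
    have hPK := DD_uniq hk len01 _ K hK P hP x hxK hx''
    subst hPK
    assumption

/-! ### Measures -/

lemma vol_iv {I : ℝ × ℝ} : volume (ivSet I) = ENNReal.ofReal (len I) := by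
  simp [ivSet, len, Real.volume_Ico]

lemma vol_iv_real {I : ℝ × ℝ} (h : 0 ≤ len I) : volume.real (ivSet I) = len I := by
  rw [Measure.real, vol_iv, ENNReal.toReal_ofReal h]

lemma meas_iv (I : ℝ × ℝ) : MeasurableSet (ivSet I) := measurableSet_Ico

lemma DD_mem_of {k : ℕ} {i m : ℕ} {K : ℝ × ℝ} (hK : K ∈ DD k (0, 1) i) :
    DD k K m ⊆ DD k (0, 1) (i + m) := by
  intro P hP
  rw [DD_add, Finset.mem_biUnion]
  exact ⟨K, hK, hP⟩

lemma len_BB {k : ℕ} (hk : 1 ≤ k) (ch : ℝ × ℝ → Bool) {K : ℝ × ℝ} (h : 0 < len K) {m : ℕ}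
    {K' : ℝ × ℝ} (hK' : K' ∈ DD k K m) :
    len (IJ k ch (mid K')) = (zz k / 3) ^ (m + 1) * len K := by
  rw [(IJ_spec hk ch (DD_len_pos h m K' hK')).2.2, DD_len m K' hK']; ring

lemma aa_pos (k : ℕ) : 0 < aa k := by unfold aa; positivity

lemma NN_zz {k : ℕ} (hk : 1 ≤ k) (m : ℕ) :
    ((3 : ℝ) ^ (k - 1)) ^ m * (zz k / 3) ^ (m + 1) = zz k / 3 * (1 / 3) ^ m := by
  have h := zz_mul hk
  rw [pow_succ, ← mul_assoc, ← mul_pow]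
  rw [show (3 : ℝ) ^ (k - 1) * (zz k / 3) = 1 / 3 by rw [← h]; ring]
  ring

lemma int_GG {k : ℕ} (hk : 1 ≤ k) (ch : ℝ × ℝ → Bool) {i : ℕ} {K : ℝ × ℝ}
    (hK : K ∈ DD k (0, 1) i) (m : ℕ) :
    ∫ x in ivSet K, GG k ch (i + m) x
      = aa k ^ (i + m + 1) * (zz k / 3 * (1 / 3) ^ m * len K) := by
  have hl := DD_len_pos len01 _ K hK
  have e : ∀ x ∈ ivSet K, GG k ch (i + m) x =
      ∑ K' ∈ DD k K m, Set.indicator (BB k ch K') (fun _ => aa k ^ (i + m + 1)) x := by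
    intro x hx
    unfold GG
    symm
    apply Finset.sum_subset (DD_mem_of hK)
    intro K' h1 h2
    rw [Set.indicator_of_notMem]
    intro hx'
    obtain ⟨m', hm, h3⟩ := exists_desc hk ch hK h1 hx hx'
    obtain rfl : m = m' := by omega
    exact h2 h3
  rw [setIntegral_congr_fun (meas_iv K) e, integral_finsetSum]
  · have e2 : ∀ K' ∈ DD k K m, ∫ x in ivSet K,
        Set.indicator (BB k ch K') (fun _ => aa k ^ (i + m + 1)) x
        = aa k ^ (i + m + 1) * ((zz k / 3) ^ (m + 1) * len K) := by
      intro K' hK'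
      have hsub : BB k ch K' ⊆ ivSet K :=
        (IJ_spec hk ch (DD_len_pos hl m K' hK')).1.trans (DD_sub hk hl m K' hK')
      rw [setIntegral_indicator (t := BB k ch K') (meas_iv _), Set.inter_eq_right.2 hsub, setIntegral_const]
      unfold BB
      have := len_BB hk ch hl hK'
      rw [vol_iv_real, this, smul_eq_mul, mul_comm]
      rw [this]; have := zz_pos k; positivity
    rw [Finset.sum_congr rfl e2, Finset.sum_const, DD_card hk hl, nsmul_eq_mul, ← NN_zz hk]
    push_cast
    ring
  · intro K' hK'
    apply Integrable.indicator _ (meas_iv _)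
    rw [integrable_const_iff]
    right
    rw [isFiniteMeasure_restrict, vol_iv]
    exact ENNReal.ofReal_ne_top

lemma int_GG_lt {k : ℕ} (hk : 1 ≤ k) (ch : ℝ × ℝ → Bool) {i : ℕ} {K : ℝ × ℝ}
    (hK : K ∈ DD k (0, 1) i) {j : ℕ} (hj : j < i) :
    ∫ x in ivSet K, GG k ch j x = 0 := by
  have e : ∀ x ∈ ivSet K, GG k ch j x = 0 := by
    intro x hx
    unfold GG
    apply Finset.sum_eq_zero
    intro K' hK'
    rw [Set.indicator_of_notMem]
    intro hx'
    exact sep hk ch hj hK' hK hx' hx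
  rw [setIntegral_congr_fun (meas_iv K) e]
  simp

lemma GG_nonneg (k : ℕ) (ch : ℝ × ℝ → Bool) (j : ℕ) (x : ℝ) : 0 ≤ GG k ch j x := by
  unfold GG
  apply Finset.sum_nonneg
  intro K _
  apply Set.indicator_nonneg
  intro _ _
  have := aa_pos k
  positivity

lemma GG_int (k : ℕ) (ch : ℝ × ℝ → Bool) (j : ℕ) (K : ℝ × ℝ) :
    IntegrableOn (GG k ch j) (ivSet K) := by
  unfold GG IntegrableOn
  apply integrable_finsetSum
  intro K' _
  apply Integrable.indicator _ (meas_iv _)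
  rw [integrable_const_iff]
  right
  rw [isFiniteMeasure_restrict, vol_iv]
  exact ENNReal.ofReal_ne_top

lemma aa_eq {k : ℕ} (hk : 1 ≤ k) : aa k = 3 * (1 - 1 / ((3 : ℝ) ^ (k - 1) + 1)) := by
  unfold aa
  obtain ⟨m, rfl⟩ : ∃ m, k = m + 1 := ⟨k - 1, by omega⟩
  have : (0 : ℝ) < 3 ^ m + 1 := by positivity
  simp only [Nat.add_sub_cancel]
  field_simp
  ring

lemma zz3 {k : ℕ} (hk : 1 ≤ k) : zz k / 3 = ((3 : ℝ) ^ k)⁻¹ := by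
  have h := zz_mul hk
  obtain ⟨m, rfl⟩ : ∃ m, k = m + 1 := ⟨k - 1, by omega⟩
  simp only [Nat.add_sub_cancel] at h
  refine eq_inv_of_mul_eq_one_left ?_
  rw [pow_succ]
  linarith

lemma aa_sum {k : ℕ} (hk : 1 ≤ k) (i : ℕ) (l : ℝ) :
    HasSum (fun m : ℕ => aa k ^ (i + m + 1) * (zz k / 3 * (1 / 3) ^ m * l)) (aa k ^ i * l) := by
  set n : ℝ := (3 : ℝ) ^ (k - 1) + 1 with hn
  have hn1 : 1 < n := by
    have : (0 : ℝ) < 3 ^ (k - 1) := by positivity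
    linarith
  have ha := aa_eq hk
  rw [← hn] at ha
  have hr : aa k / 3 = 1 - 1 / n := by rw [ha]; ring
  have h1n : 1 / n < 1 := by rw [div_lt_one (by linarith)]; exact hn1
  have h0n : 0 < 1 / n := by positivity
  have hs := hasSum_geometric_of_lt_one (r := aa k / 3) (by rw [hr]; linarith)
    (by rw [hr]; linarith)
  have hs2 := hs.mul_left (aa k ^ (i + 1) * (zz k / 3) * l)
  have e1 : (fun m : ℕ => aa k ^ (i + m + 1) * (zz k / 3 * (1 / 3) ^ m * l)) =
      fun m : ℕ => aa k ^ (i + 1) * (zz k / 3) * l * (aa k / 3) ^ m := by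
    ext m
    rw [div_pow, div_pow, one_pow]
    ring
  have e2 : aa k ^ i * l = aa k ^ (i + 1) * (zz k / 3) * l * (1 - aa k / 3)⁻¹ := by
    have : (1 - aa k / 3)⁻¹ = n := by rw [hr]; simp
    rw [this, zz3 hk, pow_succ]
    have : aa k * n = 3 ^ k := by
      unfold aa; rw [← hn]; field_simp
    have h3 : (3 : ℝ) ^ k ≠ 0 := by positivity
    calc aa k ^ i * l = aa k ^ i * l * (3 ^ k * (3 ^ k)⁻¹) := by rw [mul_inv_cancel₀ h3, mul_one]
      _ = _ := by nth_rewrite 1 [← this]; ring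
  rw [e1, e2]
  exact hs2

lemma avg_wgt {k : ℕ} (hk : 1 ≤ k) (ch : ℝ × ℝ → Bool) {i : ℕ} {K : ℝ × ℝ}
    (hK : K ∈ DD k (0, 1) i) : avg (wgt k ch) K = aa k ^ i := by
  have hl := DD_len_pos len01 _ K hK
  have hsum : HasSum (fun m => ∫ x in ivSet K, GG k ch m x) (aa k ^ i * len K) := by
    have h := aa_sum hk i (len K)
    have h2 : HasSum (fun m => ∫ x in ivSet K, GG k ch (m + i) x) (aa k ^ i * len K) := by
      convert h using 2 with m
      rw [add_comm, int_GG hk ch hK]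
    have h3 := (hasSum_nat_add_iff (f := fun m => ∫ x in ivSet K, GG k ch m x) i).1 h2
    rw [Finset.sum_eq_zero (fun j hj => int_GG_lt hk ch hK (Finset.mem_range.1 hj)),
      add_zero] at h3
    exact h3
  have h4 := hasSum_integral_of_summable_integral_norm (μ := volume.restrict (ivSet K))
    (F := fun j x => GG k ch j x) (fun j => GG_int k ch j K) (by
      simp only [Real.norm_eq_abs, abs_of_nonneg (GG_nonneg k ch _ _)]
      exact hsum.summable)
  have h5 := h4.unique hsum
  unfold avg mass
  simp only [wgt_eq]
  rw [h5]
  field_simp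

lemma aa_gt_one {k : ℕ} (hk : 2 ≤ k) : 1 < aa k := by
  rw [aa_eq (by omega)]
  have : (3 : ℝ) ≤ 3 ^ (k - 1) := by
    calc (3 : ℝ) = 3 ^ 1 := by norm_num
      _ ≤ 3 ^ (k - 1) := pow_le_pow_right₀ (by norm_num) (by omega)
  have : 1 / ((3 : ℝ) ^ (k - 1) + 1) ≤ 1 / 4 := by
    apply one_div_le_one_div_of_le <;> linarith
  linarith

lemma distr {k : ℕ} (hk : 2 ≤ k) (ch : ℝ × ℝ → Bool) {i : ℕ} {K : ℝ × ℝ}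
    (hK : K ∈ DD k (0, 1) i) {t : ℝ} (ht : 0 ≤ t) {m : ℕ} (hm : m = 0 ∨ aa k ^ (i + m) ≤ t) :
    (volume {x | x ∈ ivSet K ∧ t < wgt k ch x}).toReal / len K ≤
      3 / 2 * ((3 : ℝ) ^ k)⁻¹ * (1 / 3) ^ m := by
  have hk1 : 1 ≤ k := by omega
  have hl := DD_len_pos len01 _ K hK
  have hsub : {x | x ∈ ivSet K ∧ t < wgt k ch x} ⊆
      ⋃ l : ℕ, ⋃ K' ∈ DD k K (m + l), BB k ch K' := by
    rintro x ⟨hxK, hx⟩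
    obtain ⟨j, K', hK', hxB⟩ := exists_of_wgt_pos ch (ht.trans_lt hx)
    rw [wgt_of_mem hk1 ch hK' hxB] at hx
    obtain ⟨m', rfl, h'⟩ := exists_desc hk1 ch hK hK' hxK hxB
    have hmm : m ≤ m' := by
      rcases hm with rfl | hm
      · omega
      · have := (pow_lt_pow_iff_right₀ (aa_gt_one hk)).1 (hm.trans_lt hx)
        omega
    obtain ⟨l, rfl⟩ := Nat.exists_eq_add_of_le hmm
    simp only [mem_iUnion]
    exact ⟨l, K', h', hxB⟩
  have hz := zz_pos k
  have hS : HasSum (fun l : ℕ => zz k / 3 * (1 / 3) ^ (m + l) * len K)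
      (3 / 2 * (zz k / 3) * (1 / 3) ^ m * len K) := by
    have := (hasSum_geometric_of_lt_one (r := (1 / 3 : ℝ)) (by norm_num) (by norm_num)).mul_left
      (zz k / 3 * (1 / 3) ^ m * len K)
    have e1 : (fun l : ℕ => zz k / 3 * (1 / 3) ^ (m + l) * len K) =
        fun l : ℕ => zz k / 3 * (1 / 3) ^ m * len K * (1 / 3) ^ l := by
      ext l; rw [pow_add]; ring
    have e2 : 3 / 2 * (zz k / 3) * (1 / 3) ^ m * len K =
        zz k / 3 * (1 / 3) ^ m * len K * (1 - 1 / 3)⁻¹ := by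
      rw [show (1 - 1 / 3 : ℝ)⁻¹ = 3 / 2 by norm_num]; ring
    rw [e1, e2]
    exact this
  have hb : volume {x | x ∈ ivSet K ∧ t < wgt k ch x} ≤
      ENNReal.ofReal (3 / 2 * (zz k / 3) * (1 / 3) ^ m * len K) := by
    calc volume {x | x ∈ ivSet K ∧ t < wgt k ch x}
        ≤ volume (⋃ l : ℕ, ⋃ K' ∈ DD k K (m + l), BB k ch K') := measure_mono hsub
      _ ≤ ∑' l : ℕ, volume (⋃ K' ∈ DD k K (m + l), BB k ch K') := measure_iUnion_le _
      _ ≤ ∑' l : ℕ, ENNReal.ofReal (zz k / 3 * (1 / 3) ^ (m + l) * len K) := by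
          apply ENNReal.tsum_le_tsum
          intro l
          refine (measure_biUnion_finset_le _ _).trans ?_
          have e : ∀ K' ∈ DD k K (m + l), volume (BB k ch K') =
              ENNReal.ofReal ((zz k / 3) ^ (m + l + 1) * len K) := by
            intro K' hK'
            rw [BB, vol_iv, len_BB hk1 ch hl hK']
          rw [Finset.sum_congr rfl e, Finset.sum_const, DD_card hk1 hl, nsmul_eq_mul,
            ← NN_zz hk1, ← ENNReal.ofReal_natCast, ← ENNReal.ofReal_mul (by positivity)]
          apply le_of_eq
          congr 1
          push_cast
          ring
      _ = ENNReal.ofReal (3 / 2 * (zz k / 3) * (1 / 3) ^ m * len K) := by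
          rw [← hS.tsum_eq, ENNReal.ofReal_tsum_of_nonneg _ hS.summable]
          intro l; positivity
  rw [div_le_iff₀ hl, ← zz3 hk1]
  have := ENNReal.toReal_mono ENNReal.ofReal_ne_top hb
  rwa [ENNReal.toReal_ofReal (by positivity)] at this

/-! ### Analysis -/

lemma L_ge {s : ℝ} (h0 : 0 ≤ s) (h1 : s ≤ 1) : 12 ≤ 12 - Real.log s := by
  have := Real.log_nonpos h0 h1
  linarith

lemma logL_ge {L : ℝ} (h : 12 ≤ L) : 1 ≤ Real.log L := by
  rw [Real.le_log_iff_exp_le (by linarith)]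
  have := Real.exp_one_lt_d9
  linarith

lemma psi_nonneg (r : ℝ) {s : ℝ} (h0 : 0 ≤ s) (h1 : s ≤ 1) : 0 ≤ psi r s := by
  have h := L_ge h0 h1
  have h' := logL_ge h
  unfold psi
  have : 0 ≤ Real.log (12 - Real.log s) := by linarith
  have : 0 ≤ 12 - Real.log s := by linarith
  positivity

lemma psi_le_const {r : ℝ} (hr2 : r < 2) {s : ℝ} (h0 : 0 ≤ s) (h1 : s ≤ 1) :
    psi r s ≤ 27 * Real.exp 12 := by
  rcases h0.eq_or_lt with rfl | hs
  · simp [psi]; positivity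
  have h := L_ge h0 h1
  have h' := logL_ge h
  unfold psi
  have es : s = Real.exp (12 - (12 - Real.log s)) := by
    rw [sub_sub_cancel, Real.exp_log hs]
  set L := 12 - Real.log s with hL
  have b1 : Real.log L ^ r ≤ L ^ 2 := by
    calc Real.log L ^ r ≤ Real.log L ^ (2 : ℝ) := Real.rpow_le_rpow_of_exponent_le h' hr2.le
      _ = Real.log L ^ 2 := by norm_num
      _ ≤ L ^ 2 := by
        gcongr
        linarith [Real.log_le_sub_one_of_pos (show 0 < L by linarith)]
  have b2 : L ^ 3 ≤ 27 * Real.exp L := by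
    have : L / 3 ≤ Real.exp (L / 3) := by linarith [Real.add_one_le_exp (L / 3)]
    calc L ^ 3 = 27 * (L / 3) ^ 3 := by ring
      _ ≤ 27 * (Real.exp (L / 3)) ^ 3 := by gcongr
      _ = 27 * Real.exp L := by rw [← Real.exp_nat_mul]; congr 2; push_cast; ring
  have hL0 : 0 ≤ L := by linarith
  calc s * L * Real.log L ^ r ≤ s * L * L ^ 2 := by gcongr
    _ = s * L ^ 3 := by ring
    _ ≤ s * (27 * Real.exp L) := by gcongr
    _ = 27 * (Real.exp (12 - L) * Real.exp L) := by rw [← es]; ring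
    _ = 27 * Real.exp 12 := by rw [← Real.exp_add]; congr 2; ring

lemma psi_le_pow {r : ℝ} (hr1 : 1 < r) (hr2 : r < 2) {n κ : ℝ} (hn : 1 ≤ n) (hκ : 1 ≤ κ)
    (hnκ : Real.log n ≤ 2 * κ) {s : ℝ} (h0 : 0 ≤ s) (h1 : s ≤ 1) :
    psi r s ≤ 6912 * Real.exp 4 * n * κ ^ r * s ^ (1 - 1 / (4 * n)) := by
  rcases h0.eq_or_lt with rfl | hs
  · have : (0 : ℝ) ≤ (0 : ℝ) ^ (1 - 1 / (4 * n)) := Real.rpow_nonneg le_rfl _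
    simp [psi]
    positivity
  have h := L_ge h0 h1
  have h' := logL_ge h
  unfold psi
  have el : Real.log s = 12 - (12 - Real.log s) := by ring
  have es : s ^ (1 - 1 / (4 * n)) = s * Real.exp ((12 - Real.log s - 12) / (4 * n)) := by
    rw [sub_eq_add_neg, Real.rpow_add hs, Real.rpow_one, Real.rpow_def_of_pos hs]
    congr 2
    ring
  rw [es]
  set L := 12 - Real.log s with hL
  have hL0 : 0 < L := by linarith
  set x := L / n with hx
  have hx0 : 0 < x := by positivity
  have hLx : L = n * x := by rw [hx]; field_simp
  have b0 : Real.log L ≤ 2 * κ * (1 + x) := by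
    rw [hLx, Real.log_mul (by positivity) (by positivity)]
    have := Real.log_le_sub_one_of_pos hx0
    nlinarith
  have b1 : Real.log L ^ r ≤ 4 * κ ^ r * (1 + x) ^ 2 := by
    calc Real.log L ^ r ≤ (2 * κ * (1 + x)) ^ r :=
          Real.rpow_le_rpow (by linarith) b0 (by linarith)
      _ = 2 ^ r * κ ^ r * (1 + x) ^ r := by
          rw [Real.mul_rpow (by positivity) (by positivity),
            Real.mul_rpow (by positivity) (by positivity)]
      _ ≤ 2 ^ (2 : ℝ) * κ ^ r * (1 + x) ^ (2 : ℝ) := by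
          gcongr
          · norm_num
          · linarith
      _ = 4 * κ ^ r * (1 + x) ^ 2 := by norm_num
  have b2 : (1 + x) ^ 3 ≤ 1728 * Real.exp ((1 + x) / 4) := by
    have : (1 + x) / 12 ≤ Real.exp ((1 + x) / 12) := by
      linarith [Real.add_one_le_exp ((1 + x) / 12)]
    calc (1 + x) ^ 3 = 1728 * ((1 + x) / 12) ^ 3 := by ring
      _ ≤ 1728 * (Real.exp ((1 + x) / 12)) ^ 3 := by gcongr
      _ = 1728 * Real.exp ((1 + x) / 4) := by
        rw [← Real.exp_nat_mul]; congr 2; push_cast; ring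
  have b3 : Real.exp ((1 + x) / 4) ≤ Real.exp 4 * Real.exp ((L - 12) / (4 * n)) := by
    rw [← Real.exp_add]
    apply Real.exp_le_exp.2
    have : (L - 12) / (4 * n) = x / 4 - 3 / n := by rw [hx]; field_simp; ring
    rw [this]
    have : 3 / n ≤ 3 := by rw [div_le_iff₀ (by linarith)]; linarith
    linarith
  have hκr : 0 ≤ κ ^ r := by positivity
  calc s * L * Real.log L ^ r ≤ s * L * (4 * κ ^ r * (1 + x) ^ 2) := by gcongr
    _ = s * n * 4 * κ ^ r * (x * (1 + x) ^ 2) := by rw [hLx]; ring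
    _ ≤ s * n * 4 * κ ^ r * ((1 + x) * (1 + x) ^ 2) := by gcongr; linarith
    _ = s * n * 4 * κ ^ r * (1 + x) ^ 3 := by ring
    _ ≤ s * n * 4 * κ ^ r * (1728 * (Real.exp 4 * Real.exp ((L - 12) / (4 * n)))) := by
        gcongr
        exact b2.trans (by gcongr)
    _ = _ := by ring

lemma int_bound {f : ℝ → ℝ} {A c p : ℝ} (hA : 0 < A) (hp : 1 < p)
    (hf0 : ∀ t, 0 < t → 0 ≤ f t) (hf1 : ∀ t, 0 < t → t ≤ A → f t ≤ c)
    (hf2 : ∀ t, A < t → f t ≤ c * (t / A) ^ (-p)) :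
    ∫ t in Ioi (0 : ℝ), f t ≤ c * A + c * A / (p - 1) := by
  set g : ℝ → ℝ := fun t => if t ≤ A then c else c * A ^ p * t ^ (-p) with hg
  have u : Ioi (0 : ℝ) = Ioc 0 A ∪ Ioi A := (Ioc_union_Ioi_eq_Ioi hA.le).symm
  have g1 : EqOn g (fun _ => c) (Ioc 0 A) := fun t ht => by simp [hg, ht.2]
  have g2 : EqOn g (fun t => c * A ^ p * t ^ (-p)) (Ioi A) := fun t ht => by
    have : ¬ t ≤ A := not_le.2 ht
    simp [hg, this]
  have i1 : IntegrableOn g (Ioc 0 A) := by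
    rw [integrableOn_congr_fun g1 measurableSet_Ioc]
    exact integrableOn_const (by simp)
  have i2 : IntegrableOn g (Ioi A) := by
    rw [integrableOn_congr_fun g2 measurableSet_Ioi]
    exact (integrableOn_Ioi_rpow_of_lt (by linarith) hA).const_mul _
  have ig : IntegrableOn g (Ioi 0) := by rw [u]; exact i1.union i2
  have hle : ∫ t in Ioi (0 : ℝ), f t ≤ ∫ t in Ioi (0 : ℝ), g t := by
    apply integral_mono_of_nonneg _ ig
    · filter_upwards [ae_restrict_mem measurableSet_Ioi] with t ht
      by_cases h : t ≤ A
      · simp only [hg, h, if_true]; exact hf1 t ht h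
      · simp only [hg, h, if_false]
        push Not at h
        have ht' : 0 < t := ht
        have := hf2 t h
        rw [Real.div_rpow ht'.le hA.le, Real.rpow_neg hA.le, div_inv_eq_mul] at this
        linarith
    · filter_upwards [ae_restrict_mem measurableSet_Ioi] with t ht
      exact hf0 t ht
  refine hle.trans (le_of_eq ?_)
  have hd : Disjoint (Ioc 0 A) (Ioi A) := by
    rw [Set.disjoint_left]; intro t h1 h2; exact not_lt.2 h1.2 h2
  rw [u, setIntegral_union hd measurableSet_Ioi i1 i2, setIntegral_congr_fun measurableSet_Ioc g1,
    setIntegral_congr_fun measurableSet_Ioi g2, setIntegral_const, integral_const_mul,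
    integral_Ioi_rpow_of_lt (by linarith) hA]
  have hp1 : p - 1 ≠ 0 := by linarith
  have hp2 : -p + 1 ≠ 0 := by linarith
  have e : A ^ p * A ^ (-p + 1) = A := by
    rw [← Real.rpow_add hA]; simp
  have e3 : -A ^ (-p + 1) / (-p + 1) = A ^ (-p + 1) / (p - 1) := by
    rw [show -p + 1 = -(p - 1) by ring, neg_div_neg_eq]
  rw [e3]
  have e4 : c * A ^ p * (A ^ (-p + 1) / (p - 1)) = c * (A ^ p * A ^ (-p + 1)) / (p - 1) := by ring
  rw [e4, e]
  simp [Measure.real, hA.le]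
  ring

lemma mu_bd {f : ℝ → ℝ} {K : ℝ × ℝ} (h : 0 < len K) (t : ℝ) :
    0 ≤ (volume {x | x ∈ ivSet K ∧ t < f x}).toReal / len K ∧
    (volume {x | x ∈ ivSet K ∧ t < f x}).toReal / len K ≤ 1 := by
  refine ⟨by positivity, ?_⟩
  rw [div_le_one h]
  have hs : volume {x | x ∈ ivSet K ∧ t < f x} ≤ ENNReal.ofReal (len K) := by
    rw [← vol_iv]; exact measure_mono fun x hx => hx.1
  have := ENNReal.toReal_mono ENNReal.ofReal_ne_top hs
  rwa [ENNReal.toReal_ofReal h.le] at this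

lemma sigma_bd {r : ℝ} (hr2 : r < 2) {k : ℕ} (hk : 2 ≤ k) (ch : ℝ × ℝ → Bool)
    {i : ℕ} {K : ℝ × ℝ} (hK : K ∈ DD k (0, 1) i) :
    lorentz (psi r) (sgm2 k ch) K ≤ 27 * Real.exp 12 * (aa k ^ i)⁻¹ := by
  have hl := DD_len_pos len01 _ K hK
  have ha := aa_gt_one hk
  have ha0 := aa_pos k
  unfold lorentz
  set A := (aa k ^ i)⁻¹ with hA
  have hA0 : 0 < A := by positivity
  have hz : ∀ t, A < t → psi r ((volume {x | x ∈ ivSet K ∧ t < sgm2 k ch x}).toReal / len K)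
      = 0 := by
    intro t ht
    have : {x | x ∈ ivSet K ∧ t < sgm2 k ch x} = ∅ := by
      rw [Set.eq_empty_iff_forall_notMem]
      rintro x ⟨hxK, hx⟩
      unfold sgm2 at hx
      split_ifs at hx with hw
      · obtain ⟨j, K', hK', hxB⟩ := exists_of_wgt_pos ch hw
        obtain ⟨m, rfl, -⟩ := exists_desc (by omega) ch hK hK' hxK hxB
        rw [wgt_of_mem (by omega) ch hK' hxB] at hx
        have : (aa k ^ (i + m + 1))⁻¹ ≤ A := by
          rw [hA]
          apply inv_anti₀ (by positivity)
          exact pow_le_pow_right₀ ha.le (by omega)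
        linarith
      · linarith
    rw [this]
    simp [psi]
  have hb : ∀ t, ‖psi r ((volume {x | x ∈ ivSet K ∧ t < sgm2 k ch x}).toReal / len K)‖
      ≤ 27 * Real.exp 12 := by
    intro t
    obtain ⟨h1, h2⟩ := mu_bd (f := sgm2 k ch) hl t
    rw [Real.norm_eq_abs, abs_of_nonneg (psi_nonneg r h1 h2)]
    exact psi_le_const hr2 h1 h2
  have e : ∫ t in Ioi (0 : ℝ), psi r ((volume {x | x ∈ ivSet K ∧ t < sgm2 k ch x}).toReal / len K)
      = ∫ t in Ioc (0 : ℝ) A,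
        psi r ((volume {x | x ∈ ivSet K ∧ t < sgm2 k ch x}).toReal / len K) := by
    apply setIntegral_eq_of_subset_of_forall_sdiff_eq_zero measurableSet_Ioi Ioc_subset_Ioi_self
    rintro t ⟨h1, h2⟩
    apply hz
    by_contra hcon
    exact h2 ⟨h1, not_lt.1 hcon⟩
  rw [e]
  have h3 := norm_setIntegral_le_of_norm_le_const (μ := volume) (s := Ioc (0 : ℝ) A) (by simp)
    (fun t _ => hb t)
  refine (Real.le_norm_self _).trans (h3.trans (le_of_eq ?_))
  simp [Measure.real, hA0.le]

lemma aa_rpow {k : ℕ} (hk : 1 ≤ k) :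
    aa k ^ (1 + 1 / (2 * ((3 : ℝ) ^ (k - 1) + 1))) ≤ 3 := by
  have ha := aa_pos k
  set n : ℝ := (3 : ℝ) ^ (k - 1) + 1 with hn
  have hn1 : 1 < n := by
    have : (0 : ℝ) < 3 ^ (k - 1) := by positivity
    linarith
  have hae := aa_eq hk
  rw [← hn] at hae
  have h1n : 1 / n < 1 := by rw [div_lt_one (by linarith)]; exact hn1
  have h0n : 0 < 1 / n := by positivity
  have hlog : Real.log (aa k) ≤ Real.log 3 - 1 / n := by
    rw [hae, Real.log_mul (by norm_num) (by linarith)]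
    have := Real.log_le_sub_one_of_pos (show 0 < 1 - 1 / n by linarith)
    linarith
  have h3 : Real.log 3 ≤ 2 := by
    have := Real.log_le_sub_one_of_pos (show (0 : ℝ) < 3 by norm_num)
    linarith
  rw [Real.rpow_def_of_pos ha, ← Real.le_log_iff_exp_le (by norm_num)]
  have e : 1 / (2 * n) = 1 / n / 2 := by ring
  rw [e]
  set y := 1 / n
  nlinarith

lemma w_bd {r : ℝ} (hr1 : 1 < r) (hr2 : r < 2) {k : ℕ} (hk : 2 ≤ k) (ch : ℝ × ℝ → Bool)
    {i : ℕ} {K : ℝ × ℝ} (hK : K ∈ DD k (0, 1) i) :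
    lorentz (psi r) (wgt k ch) K ≤
      933120 * Real.exp 4 * ((3 : ℝ) ^ k * (k : ℝ) ^ r * aa k ^ i) := by
  have hk1 : 1 ≤ k := by omega
  have hl := DD_len_pos len01 _ K hK
  have ha := aa_gt_one hk
  have ha0 := aa_pos k
  have har := aa_rpow hk1
  set n : ℝ := (3 : ℝ) ^ (k - 1) + 1 with hn
  have h3k : (3 : ℝ) ^ k = 3 * 3 ^ (k - 1) := by
    rw [← pow_succ']; congr 1; omega
  have h31 : (1 : ℝ) ≤ 3 ^ (k - 1) := one_le_pow₀ (by norm_num)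
  have hn1 : 1 ≤ n := by linarith
  have hnk : n ≤ 3 ^ k := by linarith
  have hκ : (1 : ℝ) ≤ k := by exact_mod_cast hk1
  have hl3 : Real.log 3 ≤ 2 := by
    have := Real.log_le_sub_one_of_pos (show (0 : ℝ) < 3 by norm_num)
    linarith
  have hlogn : Real.log n ≤ 2 * k := by
    calc Real.log n ≤ Real.log (3 ^ k) := Real.log_le_log (by linarith) hnk
      _ = k * Real.log 3 := Real.log_pow _ _
      _ ≤ k * 2 := by gcongr
      _ = 2 * k := by ring
  have hkn : (k : ℝ) ≤ 4 * n := by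
    have h1 : k - 1 < 3 ^ (k - 1) := Nat.lt_pow_self (by norm_num)
    have h2 : k ≤ 3 ^ (k - 1) := by omega
    have h3 : (k : ℝ) ≤ 3 ^ (k - 1) := by exact_mod_cast h2
    linarith
  set A := aa k ^ i with hA
  have hA0 : 0 < A := by positivity
  set M : ℝ := 6912 * Real.exp 4 * n * (k : ℝ) ^ r with hM
  have hM0 : 0 < M := by positivity
  set θ : ℝ := 1 - 1 / (4 * n) with hθ
  set q : ℝ := 1 + 1 / (2 * n) with hq
  have hy : 1 / (4 * n) = 1 / n / 4 := by ring
  have hy2 : 1 / (2 * n) = 1 / n / 2 := by ring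
  have hy0 : 0 < 1 / n := by positivity
  have hy1 : 1 / n ≤ 1 := by rw [div_le_one (by linarith)]; exact hn1
  have hθ0 : 0 < θ := by rw [hθ, hy]; linarith
  have hqθ : 1 + 1 / (8 * n) ≤ q * θ := by
    rw [hθ, hq, hy, hy2, show 1 / (8 * n) = 1 / n / 8 by ring]
    set y := 1 / n
    nlinarith
  set c : ℝ := M * (15 * ((3 : ℝ) ^ k)⁻¹) with hc
  have h5 : (5 * ((3 : ℝ) ^ k)⁻¹) ^ θ ≤ 15 * ((3 : ℝ) ^ k)⁻¹ := by
    rw [Real.mul_rpow (by norm_num) (by positivity)]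
    have e1 : (5 : ℝ) ^ θ ≤ 5 := by
      calc (5 : ℝ) ^ θ ≤ 5 ^ (1 : ℝ) := by
            apply Real.rpow_le_rpow_of_exponent_le (by norm_num)
            rw [hθ, hy]; linarith
        _ = 5 := Real.rpow_one _
    have e2 : (((3 : ℝ) ^ k)⁻¹) ^ θ ≤ ((3 : ℝ) ^ k)⁻¹ * 3 := by
      rw [hθ, sub_eq_add_neg, Real.rpow_add (by positivity), Real.rpow_one]
      gcongr
      rw [Real.rpow_neg (by positivity), Real.inv_rpow (by positivity), inv_inv,
        ← Real.rpow_natCast, ← Real.rpow_mul (by norm_num)]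
      calc (3 : ℝ) ^ ((k : ℝ) * (1 / (4 * n))) ≤ 3 ^ (1 : ℝ) := by
            apply Real.rpow_le_rpow_of_exponent_le (by norm_num)
            rw [mul_one_div, div_le_one (by linarith)]
            exact hkn
        _ = 3 := Real.rpow_one _
    calc (5 : ℝ) ^ θ * (((3 : ℝ) ^ k)⁻¹) ^ θ ≤ 5 * (((3 : ℝ) ^ k)⁻¹ * 3) := by gcongr
      _ = _ := by ring
  have key : lorentz (psi r) (wgt k ch) K ≤ c * A + c * A / (1 + 1 / (8 * n) - 1) := by
    unfold lorentz
    apply int_bound hA0 (by have : 0 < 1 / (8 * n) := by positivity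
                            linarith)
    · intro t _
      obtain ⟨h1, h2⟩ := mu_bd (f := wgt k ch) hl t
      exact psi_nonneg r h1 h2
    · intro t ht _
      obtain ⟨h1, h2⟩ := mu_bd (f := wgt k ch) hl t
      have h3 := distr hk ch hK ht.le (m := 0) (Or.inl rfl)
      refine (psi_le_pow hr1 hr2 hn1 hκ hlogn h1 h2).trans ?_
      rw [hc, hM]
      gcongr
      refine le_trans ?_ h5
      apply Real.rpow_le_rpow h1 _ hθ0.le
      refine h3.trans ?_
      rw [pow_zero, mul_one]
      gcongr
      norm_num
    · intro t ht
      have ht0 : 0 < t := hA0.trans ht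
      obtain ⟨h1, h2⟩ := mu_bd (f := wgt k ch) hl t
      have hu : 1 ≤ t / A := by rw [one_le_div hA0]; exact ht.le
      obtain ⟨m, hm1, hm2⟩ := exists_nat_pow_near hu ha
      have h3 := distr hk ch hK ht0.le (m := m) (Or.inr (by
        rw [pow_add, ← hA, mul_comm]
        exact (le_div_iff₀ hA0).1 hm1))
      have h4 : (1 / 3 : ℝ) ^ m ≤ 3 * (t / A) ^ (-q) := by
        have hu0 : 0 < t / A := by linarith
        have : (t / A) ^ q ≤ 3 ^ (m + 1) := by
          calc (t / A) ^ q ≤ (aa k ^ (m + 1)) ^ q :=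
                Real.rpow_le_rpow hu0.le hm2.le (by rw [hq]; positivity)
            _ = (aa k ^ q) ^ (m + 1) := by
                rw [← Real.rpow_natCast, ← Real.rpow_natCast, ← Real.rpow_mul ha0.le,
                  ← Real.rpow_mul ha0.le, mul_comm]
            _ ≤ 3 ^ (m + 1) := by gcongr
        rw [Real.rpow_neg hu0.le]
        have h6 : (3 * (1 / 3 : ℝ) ^ (m + 1)) ≤ 3 * ((t / A) ^ q)⁻¹ := by
          rw [one_div, inv_pow]
          gcongr
        refine le_trans (le_of_eq ?_) h6
        rw [pow_succ]; ring
      have hu0 : 0 < t / A := by linarith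
      have h7 : (volume {x | x ∈ ivSet K ∧ t < wgt k ch x}).toReal / len K ≤
          5 * ((3 : ℝ) ^ k)⁻¹ * (t / A) ^ (-q) := by
        refine h3.trans ?_
        have hp : 0 ≤ (t / A) ^ (-q) := by positivity
        have hp3 : 0 < ((3 : ℝ) ^ k)⁻¹ := by positivity
        calc 3 / 2 * ((3 : ℝ) ^ k)⁻¹ * (1 / 3) ^ m
            ≤ 3 / 2 * ((3 : ℝ) ^ k)⁻¹ * (3 * (t / A) ^ (-q)) := by gcongr
          _ = 9 / 2 * ((3 : ℝ) ^ k)⁻¹ * (t / A) ^ (-q) := by ring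
          _ ≤ 5 * ((3 : ℝ) ^ k)⁻¹ * (t / A) ^ (-q) := by gcongr; norm_num
      refine (psi_le_pow hr1 hr2 hn1 hκ hlogn h1 h2).trans ?_
      rw [← hM, hc, mul_assoc M]
      gcongr
      calc _ ≤ (5 * ((3 : ℝ) ^ k)⁻¹ * (t / A) ^ (-q)) ^ θ := Real.rpow_le_rpow h1 h7 hθ0.le
        _ = (5 * ((3 : ℝ) ^ k)⁻¹) ^ θ * (t / A) ^ (-q * θ) := by
            rw [Real.mul_rpow (by positivity) (by positivity), ← Real.rpow_mul hu0.le]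
        _ ≤ 15 * ((3 : ℝ) ^ k)⁻¹ * (t / A) ^ (-(1 + 1 / (8 * n))) := by
            gcongr ?_ * ?_
            exact Real.rpow_le_rpow_of_exponent_le hu (by linarith)
  refine key.trans ?_
  have e1 : c * A / (1 + 1 / (8 * n) - 1) = 8 * n * (c * A) := by
    rw [add_sub_cancel_left, div_div_eq_mul_div]; ring
  rw [e1]
  have hc0 : 0 < c := by positivity
  calc c * A + 8 * n * (c * A) ≤ n * (c * A) + 8 * n * (c * A) := by
        have : 0 < c * A := by positivity
        nlinarith
    _ = 933120 * Real.exp 4 * (n * n * ((3 : ℝ) ^ k)⁻¹ * (k : ℝ) ^ r * A) := by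
        rw [hc, hM]; ring
    _ ≤ 933120 * Real.exp 4 * ((3 : ℝ) ^ k * (3 : ℝ) ^ k * ((3 : ℝ) ^ k)⁻¹ * (k : ℝ) ^ r * A) := by
        gcongr
    _ = _ := by rw [mul_inv_cancel_right₀ (by positivity)]

/-- Estimate (5.3) of the paper: for `r ∈ (1,2)` there is `C(r) > 0`, independent of `k`
and of the choices of the intervals `I(J)`, with `‖w_k‖_{Λ_ψ(K)} ≤ C(r)·3^k·k^r·⟨w_k⟩_K`
and `‖σ_k‖_{Λ_ψ(K)} ≤ C(r)·⟨w_k⟩_K^{-1}` for all `K ∈ 𝐊`. -/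
theorem statement16 (r : ℝ) (hr1 : 1 < r) (hr2 : r < 2) :
    ∃ C : ℝ, 0 < C ∧ ∀ k : ℕ, 3000 < k → ∀ ch : ℝ × ℝ → Bool, ∀ K ∈ KK k,
      lorentz (psi r) (wgt k ch) K ≤ C * ((3 : ℝ) ^ k * (k : ℝ) ^ r * avg (wgt k ch) K) ∧
      lorentz (psi r) (sgm2 k ch) K ≤ C * (avg (wgt k ch) K)⁻¹ := by
  refine ⟨933120 * Real.exp 12, by positivity, ?_⟩
  intro k hk ch K hK
  obtain ⟨i, hi⟩ := mem_iUnion.1 hK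
  rw [Kfam_eq, Finset.mem_coe] at hi
  have ha := aa_pos k
  rw [avg_wgt (by omega) ch hi]
  constructor
  · refine (w_bd hr1 hr2 (by omega) ch hi).trans ?_
    gcongr
    norm_num
  · refine (sigma_bd hr2 (by omega) ch hi).trans ?_
    gcongr
    norm_num

end RTpaper
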